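/- arXiv:1912.02939 — 2 statements merged into one kernel-verified Lean document; each statement's English description precedes it below -/
import Mathlib

section
/- For every finitely generated nilpotent group G there exists a prime p such that G can be generated by d elements, where d is the dimension over the field 𝔽_p of the 𝔽_p-vector space Gᵃᵇ ⊗ 𝔽_p (equivalently, the dimension of Gᵃᵇ/(Gᵃᵇ)ᵖ, i.e. of H₁(G; 𝔽_p)). -/
open TensorProduct

open scoped commutatorElement in
theorem Subgroup.eq_top_of_sup_commutator_eq_top {G : Type*} [Group G] [Group.IsNilpotent G]
    {H : Subgroup G} (hH : H ⊔ _root_.commutator G = ⊤) : H = ⊤ := by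
  revert H
  refine Group.nilpotent_center_quotient_ind
    (P := fun G _ _ => ∀ {H : Subgroup G}, H ⊔ _root_.commutator G = ⊤ → H = ⊤) G ?_ ?_
  · intro G _ _ H _
    exact Subsingleton.elim _ _
  · intro G _ _ ih H hH
    have hsurj := QuotientGroup.mk'_surjective (Subgroup.center G)
    have hmap : H.map (QuotientGroup.mk' (Subgroup.center G)) = ⊤ := by
      apply ih
      have h := congrArg (Subgroup.map (QuotientGroup.mk' (Subgroup.center G))) hH
      rwa [Subgroup.map_sup, _root_.commutator_def, Subgroup.map_commutator,
        Subgroup.map_top_of_surjective _ hsurj, ← _root_.commutator_def] at h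
    have hcenter : H ⊔ Subgroup.center G = ⊤ := by
      have h := congrArg (Subgroup.comap (QuotientGroup.mk' (Subgroup.center G))) hmap
      rwa [Subgroup.comap_map_eq, QuotientGroup.ker_mk', Subgroup.comap_top] at h
    have hle : _root_.commutator G ≤ H := by
      rw [_root_.commutator_def, Subgroup.commutator_le]
      intro a _ b _
      obtain ⟨h, hh, z, hz, rfl⟩ := Subgroup.mem_sup_of_normal_right.1 (hcenter ▸ Subgroup.mem_top a)
      obtain ⟨k, hk, w, hw, rfl⟩ := Subgroup.mem_sup_of_normal_right.1 (hcenter ▸ Subgroup.mem_top b)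
      have key : ⁅h * z, k * w⁆ = ⁅h, k⁆ := by
        rw [Subgroup.mem_center_iff] at hz hw
        rw [commutatorElement_def, commutatorElement_def, mul_inv_rev, mul_inv_rev]
        calc h * z * (k * w) * (z⁻¹ * h⁻¹) * (w⁻¹ * k⁻¹)
            = h * (z * (k * w)) * z⁻¹ * h⁻¹ * w⁻¹ * k⁻¹ := by group
          _ = h * ((k * w) * z) * z⁻¹ * h⁻¹ * w⁻¹ * k⁻¹ := by rw [hz]
          _ = h * k * (w * h⁻¹) * w⁻¹ * k⁻¹ := by group
          _ = h * k * (h⁻¹ * w) * w⁻¹ * k⁻¹ := by rw [hw]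
          _ = h * k * h⁻¹ * k⁻¹ := by group
      rw [key, commutatorElement_def]
      exact H.mul_mem (H.mul_mem (H.mul_mem hh hk) (H.inv_mem hh)) (H.inv_mem hk)
    rwa [sup_eq_left.2 hle] at hH

theorem AddSubgroup.mem_closure_sum_of_pairwise_coprime {A ι : Type*} [AddCommGroup A]
    {t : ι → A} {q : ι → ℕ} (s : Finset ι) (hq : ∀ i ∈ s, q i • t i = 0)
    (hco : (s : Set ι).Pairwise fun i j => (q i).Coprime (q j)) {i : ι} (hi : i ∈ s) :
    t i ∈ AddSubgroup.closure {∑ k ∈ s, t k} := by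
  classical
  have hcop : (q i).Coprime (∏ k ∈ s.erase i, q k) :=
    Nat.Coprime.prod_right fun k hk =>
      hco hi (Finset.mem_of_mem_erase hk) (Finset.ne_of_mem_erase hk).symm
  obtain ⟨c, hc1, hc0⟩ := Nat.chineseRemainder hcop 1 0
  rw [AddSubgroup.mem_closure_singleton]
  refine ⟨c, ?_⟩
  rw [natCast_zsmul, Finset.smul_sum, ← Finset.add_sum_erase _ _ hi, Finset.sum_eq_zero, add_zero]
  · have h : c • t i = 1 • t i :=
      nsmul_eq_nsmul_iff_modEq.2 (hc1.of_dvd (addOrderOf_dvd_of_nsmul_eq_zero (hq i hi)))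
    rw [h, one_smul]
  · intro k hk
    obtain ⟨d, rfl⟩ := (Finset.dvd_prod_of_mem q hk).trans ((Nat.modEq_zero_iff_dvd).1 hc0)
    rw [mul_comm, mul_smul, hq k (Finset.mem_of_mem_erase hk), smul_zero]

theorem exists_fin_coloring_injOn_fibers {κ β : Type*} [Fintype κ] [DecidableEq β] (p : κ → β)
    (m : ℕ) (hm : ∀ b, Fintype.card {i // p i = b} ≤ m) :
    ∃ f : κ → Fin m, ∀ i j, f i = f j → p i = p j → i = j := by
  have h : ∀ b, Nonempty ({i // p i = b} ↪ Fin m) := fun b =>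
    Function.Embedding.nonempty_of_card_le (by simpa using hm b)
  let g := fun b => (h b).some
  refine ⟨fun i => g (p i) ⟨i, rfl⟩, fun i j hf hp => ?_⟩
  have key : ∀ b b' (hi : p i = b) (hj : p j = b'), b = b' → g b ⟨i, hi⟩ = g b' ⟨j, hj⟩ → i = j := by
    rintro b _ hi hj rfl h
    exact congrArg Subtype.val ((g b).injective h)
  exact key _ _ rfl rfl hp hf

theorem finrank_zmod_tensor_le_card {A : Type*} [AddCommGroup A] {p : ℕ} [Fact p.Prime]
    (S : Finset A) (hS : AddSubgroup.closure (S : Set A) = ⊤) :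
    Module.finrank (ZMod p) (ZMod p ⊗[ℤ] A) ≤ S.card := by
  classical
  have hspan : Submodule.span ℤ (S : Set A) = ⊤ := by
    rw [← Submodule.toAddSubgroup_inj, Submodule.span_int_eq_addSubgroupClosure, hS]; rfl
  have h := Submodule.baseChange_span (A := ZMod p) (R := ℤ) (S : Set A)
  rw [hspan, Submodule.baseChange_top, ← Finset.coe_image] at h
  rw [← finrank_top, h]
  exact (finrank_span_finset_le_card _).trans Finset.card_image_le

theorem card_le_finrank_zmod_tensor {A : Type*} [AddCommGroup A] [Module.Finite ℤ A]
    {p : ℕ} [Fact p.Prime] {ι : Type*} [Fintype ι] (f : A →+ (ι → ZMod p))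
    (hf : Function.Surjective f) :
    Fintype.card ι ≤ Module.finrank (ZMod p) (ZMod p ⊗[ℤ] A) := by
  have h : Function.Surjective (f.toIntLinearMap.liftBaseChange (ZMod p)) := fun y => by
    obtain ⟨a, rfl⟩ := hf y
    exact ⟨1 ⊗ₜ a, by simp⟩
  simpa using LinearMap.finrank_le_finrank_of_surjective h

theorem exists_prime_closure_eq_top_card_le_finrank_zmod_tensor (A : Type*) [AddCommGroup A]
    [AddGroup.FG A] : ∃ p : ℕ, p.Prime ∧ ∃ S : Finset A,
      S.card ≤ Module.finrank (ZMod p) (ZMod p ⊗[ℤ] A) ∧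
      AddSubgroup.closure (S : Set A) = ⊤ := by
  classical
  have hfin : Module.Finite ℤ A := Module.Finite.iff_addGroup_fg.mpr inferInstance
  obtain ⟨n, ι, _, p, hp, e, ⟨E⟩⟩ := AddCommGroup.equiv_free_prod_directSum_zmod A
  let κ := {i : ι // e i ≠ 0}
  let c : ℕ → ℕ := fun b => Fintype.card {i : κ // p i = b}
  obtain ⟨b, hb, hmax⟩ : ∃ b, b.Prime ∧ ∀ b', c b' ≤ c b := by
    by_cases hκ : Nonempty κ
    · obtain ⟨i, hi⟩ := Finite.exists_max fun i : κ => c (p i)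
      refine ⟨p i, hp i, fun b' => ?_⟩
      by_cases hb' : ∃ j : κ, p j = b'
      · obtain ⟨j, rfl⟩ := hb'
        exact hi j
      · have : IsEmpty {i : κ // p i = b'} := ⟨fun j => hb' ⟨j, j.2⟩⟩
        simp [c]
    · refine ⟨2, Nat.prime_two, fun b' => ?_⟩
      have : IsEmpty κ := not_nonempty_iff.1 hκ
      simp [c]
  obtain ⟨f, hf⟩ := exists_fin_coloring_injOn_fibers (fun i : κ => p i) (c b) hmax
  let t : ι → A := fun i => E.symm (0, DirectSum.of (fun i => ZMod (p i ^ e i)) i 1)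
  let x : Fin n → A := fun k => E.symm (Finsupp.single k 1, 0)
  let y : Fin (c b) → A := fun j => ∑ i : κ with f i = j, t i
  let S : Finset A := Finset.univ.image x ∪ Finset.univ.image y
  have hScard : S.card ≤ n + c b :=
    (Finset.card_union_le _ _).trans (add_le_add
      (Finset.card_image_le.trans (by simp)) (Finset.card_image_le.trans (by simp)))
  refine ⟨b, hb, S, hScard.trans ?_, ?_⟩
  · have : Fact b.Prime := ⟨hb⟩
    have hdvd : ∀ i : {i : κ // p i = b}, b ∣ p i ^ e i := fun i =>
      (dvd_of_eq i.2.symm).trans (dvd_pow_self _ i.1.2)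
    let g : (Fin n →₀ ℤ) × (DirectSum ι fun i => ZMod (p i ^ e i)) →+
        (Fin n ⊕ {i : κ // p i = b} → ZMod b) :=
      AddMonoidHom.pi fun s => Sum.elim
        (fun k => ((Int.castAddHom (ZMod b)).comp (Finsupp.applyAddHom k)).comp
          (AddMonoidHom.fst _ _))
        (fun i => ((ZMod.castHom (hdvd i) (ZMod b)).toAddMonoidHom.comp
          (DFinsupp.evalAddMonoidHom i.1.1)).comp (AddMonoidHom.snd _ _)) s
    have hg : Function.Surjective g := by
      intro v
      refine ⟨(Finsupp.equivFunOnFinite.symm fun k => ((v (Sum.inl k)).val : ℤ),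
        DFinsupp.equivFunOnFintype.symm fun i =>
          if h : ∃ hi : e i ≠ 0, p i = b then
            ((v (Sum.inr ⟨⟨i, h.1⟩, h.2⟩)).val : ZMod (p i ^ e i)) else 0), ?_⟩
      funext s
      rcases s with k | ⟨⟨i, hi⟩, hpi⟩
      · simp [g, AddMonoidHom.pi]
      · have h : ZMod.castHom (hdvd ⟨⟨i, hi⟩, hpi⟩) (ZMod b)
            (if h : ∃ hi : e i ≠ 0, p i = b then
              ((v (Sum.inr ⟨⟨i, h.1⟩, h.2⟩)).val : ZMod (p i ^ e i)) else 0) =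
            v (Sum.inr ⟨⟨i, hi⟩, hpi⟩) := by
          rw [dif_pos ⟨hi, hpi⟩, map_natCast, ZMod.natCast_zmod_val]
        exact h
    have h := card_le_finrank_zmod_tensor (g.comp E.toAddMonoidHom) (hg.comp E.surjective)
    simpa [c] using h
  · have hx : ∀ k, x k ∈ AddSubgroup.closure (S : Set A) := fun k =>
      AddSubgroup.subset_closure (by simp [S])
    have hy : ∀ j, y j ∈ AddSubgroup.closure (S : Set A) := fun j =>
      AddSubgroup.subset_closure (by simp [S])
    have hq : ∀ i, (p i ^ e i) • t i = 0 := fun i => by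
      simp only [t]
      rw [← map_nsmul, Prod.smul_mk, ← map_nsmul]
      simp
    have ht : ∀ i, t i ∈ AddSubgroup.closure (S : Set A) := by
      intro i
      by_cases hi : e i = 0
      · have h := hq i
        rw [hi, pow_zero, one_smul] at h
        rw [h]
        exact zero_mem _
      · have h := AddSubgroup.mem_closure_sum_of_pairwise_coprime (t := fun i : κ => t i)
          (q := fun i : κ => p i ^ e i) {k : κ | f k = f ⟨i, hi⟩} (fun k _ => hq k) ?_
          (i := ⟨i, hi⟩) (by simp)
        · exact (AddSubgroup.closure_le _).2 (Set.singleton_subset_iff.2 (hy _)) h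
        · intro k hk l hl hkl
          refine Nat.Coprime.pow _ _ ((Nat.coprime_primes (hp _) (hp _)).2 fun h => hkl ?_)
          simp only [Finset.coe_filter, Finset.mem_univ, true_and, Set.mem_ofPred_eq] at hk hl
          exact hf _ _ (hk.trans hl.symm) h
    rw [eq_top_iff]
    rintro a -
    obtain ⟨⟨u, v⟩, rfl⟩ := E.symm.surjective a
    have hu : (E.symm.toAddMonoidHom.comp (AddMonoidHom.inl _ _)) u ∈
        AddSubgroup.closure (S : Set A) := by
      rw [← Finsupp.univ_sum_single u, map_sum]
      refine sum_mem fun k _ => ?_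
      have hk : Finsupp.single k (u k) = u k • Finsupp.single k (1 : ℤ) := by simp
      rw [hk, map_zsmul]
      exact zsmul_mem (hx k) _
    have hv : (E.symm.toAddMonoidHom.comp (AddMonoidHom.inr _ _)) v ∈
        AddSubgroup.closure (S : Set A) := by
      induction v using DirectSum.induction_on with
      | zero => rw [map_zero]; exact zero_mem _
      | add v w hv hw => rw [map_add]; exact add_mem hv hw
      | of i z =>
        obtain ⟨m, rfl⟩ := ZMod.intCast_surjective z
        rw [← zsmul_one, map_zsmul, map_zsmul]
        exact zsmul_mem (ht i) _
    have huv : (u, v) = (u, 0) + (0, v) := by simp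
    rw [huv, map_add]
    exact add_mem hu hv

/-- For every finitely generated nilpotent group `G` there is a prime `p` such that `G`
can be generated by `d` elements, where `d = dim_{𝔽_p} (Gᵃᵇ ⊗ 𝔽_p) = β₁(G; 𝔽_p)`. -/
theorem exists_prime_generating_set_card_eq_mod_p_betti
    (G : Type) [Group G] [Group.FG G] [Group.IsNilpotent G] :
    ∃ p : ℕ, p.Prime ∧ ∃ S : Finset G,
      S.card = Module.finrank (ZMod p)
        (ZMod p ⊗[ℤ] Additive (Abelianization G)) ∧
      Subgroup.closure (S : Set G) = ⊤ := by
  classical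
  have hsurj : Function.Surjective (Abelianization.of (G := G)) := QuotientGroup.mk_surjective
  have : Group.FG (Abelianization G) := Group.fg_of_surjective hsurj
  obtain ⟨p, hp, S, hcard, hS⟩ :=
    exists_prime_closure_eq_top_card_le_finrank_zmod_tensor (Additive (Abelianization G))
  have : Fact p.Prime := ⟨hp⟩
  let F : G → Additive (Abelianization G) := fun g => Additive.ofMul (Abelianization.of g)
  obtain ⟨σ, hσ⟩ : ∃ σ : Additive (Abelianization G) → G, ∀ a, F (σ a) = a :=
    ⟨_, Function.surjInv_eq (f := F) hsurj⟩
  have himage : (S.image σ).image F = S := by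
    rw [Finset.image_image]
    simp [Function.comp_def, hσ]
  have hmap : (Subgroup.closure ((S.image σ : Finset G) : Set G)).map Abelianization.of = ⊤ := by
    have hS' : Abelianization.of '' ((S.image σ : Finset G) : Set G) =
        Additive.ofMul ⁻¹' (S : Set (Additive (Abelianization G))) := by
      have h : F '' ((S.image σ : Finset G) : Set G) = S := by
        rw [← Finset.coe_image, himage]
      ext a
      rw [Set.mem_preimage, ← h]
      rfl
    rw [MonoidHom.map_closure, hS', ← AddSubgroup.toSubgroup'_closure, hS]
    rfl
  have htop : Subgroup.closure ((S.image σ : Finset G) : Set G) = ⊤ := by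
    apply Subgroup.eq_top_of_sup_commutator_eq_top
    rw [← Abelianization.ker_of, ← Subgroup.comap_map_eq, hmap, Subgroup.comap_top]
  refine ⟨p, hp, S.image σ, le_antisymm (Finset.card_image_le.trans hcard) ?_, htop⟩
  refine (finrank_zmod_tensor_le_card S hS).trans ?_
  conv_lhs => rw [← himage]
  exact Finset.card_image_le
end

section
/- Let G be the presented group ⟨t, x ∣ r₁, r₂⟩ where r₁ = t⁴ x t⁻⁴ · (t² x² t⁻¹ x⁻¹ t⁻¹ x⁻¹)⁻¹ and r₂ = x t² x t⁻² · (t² x t⁻² x)⁻¹ (i.e., the relations t⁴xt⁻⁴ = t²x²t⁻¹x⁻¹t⁻¹x⁻¹ and xt²xt⁻² = t²xt⁻²x). Then the commutator subgroup of G is isomorphic to ℤ⁴; in particular G is metabelian. -/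
/-- The relators `r₁ = t⁴ x t⁻⁴ · (t² x² t⁻¹ x⁻¹ t⁻¹ x⁻¹)⁻¹` and
`r₂ = x t² x t⁻² · (t² x t⁻² x)⁻¹` of the Cappell–Shaneson 3-knot group, with
`t = FreeGroup.of 0`, `x = FreeGroup.of 1`. -/
def csRels : Set (FreeGroup (Fin 2)) :=
  {FreeGroup.of (0 : Fin 2) ^ (4 : ℤ) * FreeGroup.of 1 * FreeGroup.of 0 ^ (-4 : ℤ) *
     (FreeGroup.of 0 ^ (2 : ℤ) * FreeGroup.of 1 ^ (2 : ℤ) * (FreeGroup.of 0)⁻¹ *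
       (FreeGroup.of 1)⁻¹ * (FreeGroup.of 0)⁻¹ * (FreeGroup.of 1)⁻¹)⁻¹,
   FreeGroup.of (1 : Fin 2) * FreeGroup.of 0 ^ (2 : ℤ) * FreeGroup.of 1 *
     FreeGroup.of 0 ^ (-2 : ℤ) *
     (FreeGroup.of 0 ^ (2 : ℤ) * FreeGroup.of 1 * FreeGroup.of 0 ^ (-2 : ℤ) *
       FreeGroup.of 1)⁻¹}

/-- Four pairwise commuting elements of a group define a homomorphism from `ℤ⁴`. -/
def zpowersHomOfCommute {G : Type*} [Group G] (a b c d : G) (hab : Commute a b)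
    (hac : Commute a c) (had : Commute a d) (hbc : Commute b c) (hbd : Commute b d)
    (hcd : Commute c d) : Multiplicative (ℤ × ℤ × ℤ × ℤ) →* G :=
  MonoidHom.mk' (fun v => a ^ v.toAdd.1 * b ^ v.toAdd.2.1 * c ^ v.toAdd.2.2.1 * d ^ v.toAdd.2.2.2)
    (by
      intro v w
      simp only [toAdd_mul, Prod.fst_add, Prod.snd_add, zpow_add]
      generalize v.toAdd.1 = v₁, v.toAdd.2.1 = v₂, v.toAdd.2.2.1 = v₃, v.toAdd.2.2.2 = v₄
      generalize w.toAdd.1 = w₁, w.toAdd.2.1 = w₂, w.toAdd.2.2.1 = w₃, w.toAdd.2.2.2 = w₄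
      have h₂ : Commute (a ^ w₁) (b ^ v₂ * c ^ v₃ * d ^ v₄) :=
        ((hab.zpow_zpow w₁ v₂).mul_right (hac.zpow_zpow w₁ v₃)).mul_right (had.zpow_zpow w₁ v₄)
      have h₃ : Commute (b ^ w₂) (c ^ v₃ * d ^ v₄) :=
        (hbc.zpow_zpow w₂ v₃).mul_right (hbd.zpow_zpow w₂ v₄)
      have h₄ : Commute (c ^ w₃) (d ^ v₄) := hcd.zpow_zpow w₃ v₄
      calc a ^ v₁ * a ^ w₁ * (b ^ v₂ * b ^ w₂) * (c ^ v₃ * c ^ w₃) * (d ^ v₄ * d ^ w₄)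
          = a ^ v₁ * a ^ w₁ * b ^ v₂ * b ^ w₂ * c ^ v₃ * (c ^ w₃ * d ^ v₄) * d ^ w₄ := by group
        _ = a ^ v₁ * a ^ w₁ * b ^ v₂ * (b ^ w₂ * (c ^ v₃ * d ^ v₄)) * c ^ w₃ * d ^ w₄ := by
          rw [h₄.eq]; group
        _ = a ^ v₁ * (a ^ w₁ * (b ^ v₂ * c ^ v₃ * d ^ v₄)) * b ^ w₂ * c ^ w₃ * d ^ w₄ := by
          rw [h₃.eq]; group
        _ = _ := by rw [h₂.eq]; group)

/-- Multiplication by `s` on `ℤ[s] / (s⁴ - 2 s² + s + 1)` in the basis `1, s, s², s³`. -/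
def csCompanion : Equiv.Perm (ℤ × ℤ × ℤ × ℤ) where
  toFun v := (-v.2.2.2, v.1 - v.2.2.2, v.2.1 + 2 * v.2.2.2, v.2.2.1)
  invFun v := (v.2.1 - v.1, v.2.2.1 + 2 * v.1, v.2.2.2, -v.1)
  left_inv v := by ext <;> simp
  right_inv v := by ext <;> simp

/-- The affine action of the Cappell–Shaneson group on `ℤ⁴`: `t` acts by the companion matrix and
`x` by translation by the first basis vector. -/
def csAffine : PresentedGroup csRels →* Equiv.Perm (ℤ × ℤ × ℤ × ℤ) :=
  PresentedGroup.toGroup (f := ![csCompanion, Equiv.addRight (1, 0, 0, 0)]) (by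
    rintro r (rfl | rfl) <;> rw [map_mul, map_inv, mul_inv_eq_one] <;> ext v <;>
      simp [csCompanion, zpow_ofNat, zpow_neg, pow_succ, Equiv.Perm.mul_apply, mul_inv_rev,
        Equiv.Perm.inv_def] <;> ring)

theorem Commute.conj_conj {G : Type*} [Group G] {a b : G} (h : Commute a b) (g : G) :
    Commute (g * a * g⁻¹) (g * b * g⁻¹) := by
  simpa using h.map (MulAut.conj g)

theorem commute_of_csRels {G : Type*} [Group G] {t x : G}
    (h₁ : t ^ 4 * x * (t ^ 4)⁻¹ = (t ^ 2 * x * (t ^ 2)⁻¹) ^ 2 * (t * x * t⁻¹)⁻¹ * x⁻¹)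
    (h₂ : Commute x (t ^ 2 * x * (t ^ 2)⁻¹)) :
    Commute x (t * x * t⁻¹) ∧ Commute x (t ^ 3 * x * (t ^ 3)⁻¹) := by
  have h24 : Commute (t ^ 2 * x * (t ^ 2)⁻¹) (t ^ 4 * x * (t ^ 4)⁻¹) := by
    convert h₂.conj_conj (t ^ 2) using 1; group
  have e₁ : t * x * t⁻¹ = x⁻¹ * (t ^ 4 * x * (t ^ 4)⁻¹)⁻¹ * (t ^ 2 * x * (t ^ 2)⁻¹) ^ 2 := by
    rw [h₁]; generalize t ^ 2 * x * (t ^ 2)⁻¹ = y; group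
  have e₀ : x = (t ^ 4 * x * (t ^ 4)⁻¹)⁻¹ * (t ^ 2 * x * (t ^ 2)⁻¹) ^ 2 * (t * x * t⁻¹)⁻¹ := by
    rw [h₁]; generalize t ^ 2 * x * (t ^ 2)⁻¹ = y; group
  have h21 : Commute (t ^ 2 * x * (t ^ 2)⁻¹) (t * x * t⁻¹) := by
    rw [e₁]
    exact (h₂.symm.inv_right.mul_right h24.inv_right).mul_right ((Commute.refl _).pow_right 2)
  have h01 : Commute x (t * x * t⁻¹) := by
    convert h21.symm.conj_conj t⁻¹ using 1 <;> group
  have h13 : Commute (t * x * t⁻¹) (t ^ 3 * x * (t ^ 3)⁻¹) := by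
    convert h₂.conj_conj t using 1; group
  have h23 : Commute (t ^ 2 * x * (t ^ 2)⁻¹) (t ^ 3 * x * (t ^ 3)⁻¹) := by
    convert h01.conj_conj (t ^ 2) using 1; group
  have h34 : Commute (t ^ 3 * x * (t ^ 3)⁻¹) (t ^ 4 * x * (t ^ 4)⁻¹) := by
    convert h01.conj_conj (t ^ 3) using 1; group
  have h30 := (h34.inv_right.mul_right (h23.symm.pow_right 2)).mul_right h13.symm.inv_right
  rw [← e₀] at h30
  exact ⟨h01, h30.symm⟩

namespace CappellShaneson

/-- The generator `t` of the Cappell–Shaneson group. -/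
def t : PresentedGroup csRels := .of 0

/-- The generator `x` of the Cappell–Shaneson group. -/
def x : PresentedGroup csRels := .of 1

theorem conj_four :
    t ^ 4 * x * (t ^ 4)⁻¹ = (t ^ 2 * x * (t ^ 2)⁻¹) ^ 2 * (t * x * t⁻¹)⁻¹ * x⁻¹ := by
  have h : t ^ (4 : ℤ) * x * t ^ (-4 : ℤ) *
      (t ^ (2 : ℤ) * x ^ (2 : ℤ) * t⁻¹ * x⁻¹ * t⁻¹ * x⁻¹)⁻¹ = 1 :=
    PresentedGroup.one_of_mem (rels := csRels) (Or.inl rfl)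
  rw [mul_inv_eq_one] at h
  calc t ^ 4 * x * (t ^ 4)⁻¹ = t ^ (4 : ℤ) * x * t ^ (-4 : ℤ) := by group
    _ = _ := by rw [h, pow_two (t ^ 2 * x * (t ^ 2)⁻¹), zpow_two x]; group

theorem commute_zero_two : Commute x (t ^ 2 * x * (t ^ 2)⁻¹) := by
  have h : x * t ^ (2 : ℤ) * x * t ^ (-2 : ℤ) *
      (t ^ (2 : ℤ) * x * t ^ (-2 : ℤ) * x)⁻¹ = 1 :=
    PresentedGroup.one_of_mem (rels := csRels) (Or.inr rfl)
  rw [mul_inv_eq_one] at h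
  calc x * (t ^ 2 * x * (t ^ 2)⁻¹) = x * t ^ (2 : ℤ) * x * t ^ (-2 : ℤ) := by group
    _ = _ := by rw [h]; group

theorem commute_zero_one : Commute x (t * x * t⁻¹) :=
  (commute_of_csRels conj_four commute_zero_two).1

theorem commute_zero_three : Commute x (t ^ 3 * x * (t ^ 3)⁻¹) :=
  (commute_of_csRels conj_four commute_zero_two).2

/-- The homomorphism `ℤ⁴ → G` sending the `n`-th basis vector to `tⁿ x t⁻ⁿ`. -/
def translation : Multiplicative (ℤ × ℤ × ℤ × ℤ) →* PresentedGroup csRels :=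
  zpowersHomOfCommute x (t * x * t⁻¹) (t ^ 2 * x * (t ^ 2)⁻¹) (t ^ 3 * x * (t ^ 3)⁻¹)
    commute_zero_one commute_zero_two commute_zero_three
    (by convert commute_zero_one.conj_conj t using 1; simp [pow_two, mul_assoc])
    (by convert commute_zero_two.conj_conj t using 1; group)
    (by convert commute_zero_one.conj_conj (t ^ 2) using 1; group)

theorem translation_ofAdd (a b c d : ℤ) :
    translation (.ofAdd (a, b, c, d)) =
      x ^ a * (t * x * t⁻¹) ^ b * (t ^ 2 * x * (t ^ 2)⁻¹) ^ c * (t ^ 3 * x * (t ^ 3)⁻¹) ^ d :=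
  rfl

theorem csAffine_t : csAffine t = csCompanion := by
  simp [csAffine, t]

theorem csAffine_x : csAffine x = Equiv.addRight (1, 0, 0, 0) := by
  simp [csAffine, x]

theorem csCompanion_conj_addRight (v : ℤ × ℤ × ℤ × ℤ) :
    csCompanion * Equiv.addRight v * csCompanion⁻¹ = Equiv.addRight (csCompanion v) := by
  rw [mul_inv_eq_iff_eq_mul]
  ext w <;> simp [csCompanion, Equiv.Perm.mul_apply] <;> ring

theorem csAffine_translation (v : Multiplicative (ℤ × ℤ × ℤ × ℤ)) :
    csAffine (translation v) = Equiv.addRight v.toAdd := by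
  obtain ⟨⟨a, b, c, d⟩, rfl⟩ := Multiplicative.ofAdd.surjective v
  have conj_t {g : PresentedGroup csRels} {v : ℤ × ℤ × ℤ × ℤ}
      (hg : csAffine g = Equiv.addRight v) :
      csAffine (t * g * t⁻¹) = Equiv.addRight (csCompanion v) := by
    rw [map_mul, map_mul, map_inv, csAffine_t, hg, csCompanion_conj_addRight]
  have h₁ := conj_t csAffine_x
  have h₂ : csAffine (t ^ 2 * x * (t ^ 2)⁻¹) = Equiv.addRight (0, 0, 1, 0) := by
    convert conj_t h₁ using 2
    · simp [pow_two, mul_assoc]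
    · rfl
  have h₃ : csAffine (t ^ 3 * x * (t ^ 3)⁻¹) = Equiv.addRight (0, 0, 0, 1) := by
    convert conj_t h₂ using 2
    · simp [pow_succ, mul_assoc]
    · rfl
  rw [translation_ofAdd, map_mul, map_mul, map_mul, map_zpow, map_zpow, map_zpow, map_zpow, h₁, h₂,
    h₃, csAffine_x]
  ext w <;> simp [csCompanion]

theorem translation_injective : Function.Injective translation := by
  intro v w h
  have := congrArg (fun g => csAffine g 0) h
  simpa [csAffine_translation] using this

theorem conj_translation (v : Multiplicative (ℤ × ℤ × ℤ × ℤ)) :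
    t * translation v * t⁻¹ = translation (.ofAdd (csCompanion v.toAdd)) := by
  obtain ⟨⟨a, b, c, d⟩, rfl⟩ := Multiplicative.ofAdd.surjective v
  have h₁ : t * x * t⁻¹ = translation (.ofAdd (0, 1, 0, 0)) := by simp [translation_ofAdd]
  have h₂ : t * (t * x * t⁻¹) * t⁻¹ = translation (.ofAdd (0, 0, 1, 0)) := by
    simp [translation_ofAdd, pow_succ, mul_assoc]
  have h₃ : t * (t ^ 2 * x * (t ^ 2)⁻¹) * t⁻¹ = translation (.ofAdd (0, 0, 0, 1)) := by
    simp [translation_ofAdd, pow_succ, mul_assoc]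
  have h₄ : t * (t ^ 3 * x * (t ^ 3)⁻¹) * t⁻¹ = translation (.ofAdd (-1, -1, 2, 0)) := by
    have e : Multiplicative.ofAdd ((-1, -1, 2, 0) : ℤ × ℤ × ℤ × ℤ) =
        .ofAdd (0, 0, 2, 0) * .ofAdd (0, -1, 0, 0) * .ofAdd (-1, 0, 0, 0) := rfl
    have h : t * (t ^ 3 * x * (t ^ 3)⁻¹) * t⁻¹ = t ^ 4 * x * (t ^ 4)⁻¹ := by group
    rw [h, conj_four, e, map_mul, map_mul]
    simp only [translation_ofAdd]
    simp [zpow_ofNat]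
  calc t * translation (.ofAdd (a, b, c, d)) * t⁻¹
      = (t * x * t⁻¹) ^ a * (t * (t * x * t⁻¹) * t⁻¹) ^ b *
          (t * (t ^ 2 * x * (t ^ 2)⁻¹) * t⁻¹) ^ c *
          (t * (t ^ 3 * x * (t ^ 3)⁻¹) * t⁻¹) ^ d := by
        simp only [translation_ofAdd, conj_zpow]; group
    _ = _ := by
        rw [h₄, h₃, h₂, h₁]
        simp only [← map_zpow, ← map_mul]
        congr 1
        ext <;> simp [csCompanion] <;> ring

theorem closure_t_x : Subgroup.closure {t, x} = ⊤ := by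
  rw [← PresentedGroup.closure_range_of csRels]
  congr 1
  ext g
  simp [Fin.exists_fin_two, t, x, eq_comm]

theorem x_mem_range : x ∈ translation.range := ⟨.ofAdd (1, 0, 0, 0), by simp [translation_ofAdd]⟩

instance normal_range_translation : translation.range.Normal := by
  rw [← Subgroup.normalizer_eq_top_iff, eq_top_iff, ← closure_t_x, Subgroup.closure_le]
  rintro g (rfl | rfl)
  · refine Subgroup.mem_normalizer_iff.2 fun h => ⟨?_, ?_⟩
    · rintro ⟨v, rfl⟩
      exact ⟨_, (conj_translation v).symm⟩
    · rintro ⟨v, hv⟩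
      refine ⟨.ofAdd (csCompanion.symm v.toAdd), ?_⟩
      rw [← MulAut.conj_apply] at hv
      apply (MulAut.conj t).injective
      rw [← hv, MulAut.conj_apply, conj_translation]
      simp
  · exact Subgroup.le_normalizer x_mem_range

theorem x_mem_commutator : x ∈ commutator (PresentedGroup csRels) := by
  have h := congrArg Abelianization.of conj_four
  rw [← Abelianization.ker_of, MonoidHom.mem_ker]
  simp only [map_mul, map_inv, map_pow, mul_inv_cancel_comm] at h
  rw [h]
  group

theorem commutator_le_range : commutator (PresentedGroup csRels) ≤ translation.range := by
  rw [← Subgroup.Normal.quotient_commutative_iff_commutator_le]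
  let q := QuotientGroup.mk' translation.range
  have hq : (Subgroup.zpowers (q t)).comap q = ⊤ := by
    rw [eq_top_iff, ← closure_t_x, Subgroup.closure_le]
    rintro g (rfl | rfl)
    · exact Subgroup.mem_zpowers (q t)
    · have hx : q x = 1 := (QuotientGroup.eq_one_iff x).2 x_mem_range
      simp [hx]
  have mem_zpowers (g : PresentedGroup csRels) : q g ∈ Subgroup.zpowers (q t) := by
    rw [← Subgroup.mem_comap, hq]; trivial
  refine ⟨⟨fun a b => ?_⟩⟩
  obtain ⟨g, rfl⟩ := QuotientGroup.mk'_surjective _ a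
  obtain ⟨h, rfl⟩ := QuotientGroup.mk'_surjective _ b
  obtain ⟨m, hm⟩ := mem_zpowers g
  obtain ⟨n, hn⟩ := mem_zpowers h
  exact hm ▸ hn ▸ (Commute.zpow_zpow_self (q t) m n).eq

theorem range_translation : translation.range = commutator (PresentedGroup csRels) := by
  refine le_antisymm ?_ commutator_le_range
  rintro _ ⟨⟨a, b, c, d⟩, rfl⟩
  have h (g : PresentedGroup csRels) : g * x * g⁻¹ ∈ commutator (PresentedGroup csRels) :=
    Subgroup.Normal.conj_mem inferInstance x x_mem_commutator g
  exact mul_mem (mul_mem (mul_mem (zpow_mem x_mem_commutator a) (zpow_mem (h _) b))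
    (zpow_mem (h _) c)) (zpow_mem (h _) d)

end CappellShaneson

open CappellShaneson in
/-- The commutator subgroup of the group
`G = ⟨t, x ∣ t⁴xt⁻⁴ = t²x²t⁻¹x⁻¹t⁻¹x⁻¹, xt²xt⁻² = t²xt⁻²x⟩` is isomorphic to `ℤ⁴`;
in particular `G` is metabelian. -/
theorem cappell_shaneson_commutator_subgroup :
    Nonempty ((commutator (PresentedGroup csRels)) ≃*
      Multiplicative (ℤ × ℤ × ℤ × ℤ)) ∧
    ∀ a b : commutator (PresentedGroup csRels), a * b = b * a := by
  let e := (MulEquiv.subgroupCongr range_translation.symm).trans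
    (MonoidHom.ofInjective translation_injective).symm
  exact ⟨⟨e⟩, fun a b => e.injective (by rw [map_mul, map_mul, mul_comm])⟩
end
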